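/- The space (X, τ) has no isolated points: no singleton {x} is τ-open. -/

import Mathlib

open Set TopologicalSpace

/-- `I` is a σ-ideal of subsets of `X`: it contains `∅`, is closed under taking
subsets and under countable unions. -/
def IsSigmaIdeal {X : Type*} (I : Set (Set X)) : Prop :=
  ∅ ∈ I ∧ (∀ S T : Set X, S ⊆ T → T ∈ I → S ∈ I) ∧
    ∀ f : ℕ → Set X, (∀ n, f n ∈ I) → (⋃ n, f n) ∈ I

/-- The set `B_s` associated to the pattern with (finite) domain `D` and values `s`:
`B_s = ⋂_{α ∈ D} A_α^{s α}` where `A^1 = A` and `A^0 = X \ A`. -/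
def patternSet {X J : Type*} (A : J → Set X) (D : Finset J) (s : J → Bool) : Set X :=
  ⋂ α ∈ D, if s α then A α else (A α)ᶜ

/-- Two patterns are contradictory if they disagree at some common point of their domains. -/
def Contradictory {J : Type*} (p q : Finset J × (J → Bool)) : Prop :=
  ∃ α, α ∈ p.1 ∧ α ∈ q.1 ∧ p.2 α ≠ q.2 α

/-- Independence mod `I`: `B_s ∉ I` for every pattern `s`. -/
def IndependentModI {X J : Type*} (I : Set (Set X)) (A : J → Set X) : Prop :=
  ∀ (D : Finset J) (s : J → Bool), patternSet A D s ∉ I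

/-- Decomposition: every `S ⊆ X` agrees mod `I` with a countable union of `B_s`'s for
pairwise contradictory patterns. -/
def Decomposition {X J : Type*} (I : Set (Set X)) (A : J → Set X) : Prop :=
  ∀ S : Set X, ∃ P : Set (Finset J × (J → Bool)), P.Countable ∧
    P.Pairwise Contradictory ∧ symmDiff S (⋃ p ∈ P, patternSet A p.1 p.2) ∈ I

/-- Separation: disjoint members of `I` are separated by some `A_α`. -/
def SeparatesIdeal {X J : Type*} (I : Set (Set X)) (A : J → Set X) : Prop :=
  ∀ Z ∈ I, ∀ Z' ∈ I, Disjoint Z Z' → ∃ α, Z ⊆ A α ∧ Z' ⊆ (A α)ᶜ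

/-- The topology `τ` generated by the subbasis
`{A_α \ Z : α ∈ J, Z ∈ I} ∪ {(X \ A_α) \ Z : α ∈ J, Z ∈ I}`. -/
def idealTopology {X J : Type*} (I : Set (Set X)) (A : J → Set X) : TopologicalSpace X :=
  TopologicalSpace.generateFrom
    ({U | ∃ α, ∃ Z ∈ I, U = A α \ Z} ∪ {U | ∃ α, ∃ Z ∈ I, U = (A α)ᶜ \ Z})

theorem IsSigmaIdeal.union_mem {X : Type*} {I : Set (Set X)} (hI : IsSigmaIdeal I)
    {S T : Set X} (hS : S ∈ I) (hT : T ∈ I) : S ∪ T ∈ I := by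
  refine hI.2.1 _ _ ?_ (hI.2.2 (fun n => if n = 0 then S else T) fun n => ?_)
  · rintro y (hy | hy)
    · exact mem_iUnion.2 ⟨0, by simpa using hy⟩
    · exact mem_iUnion.2 ⟨1, by simpa using hy⟩
  · split_ifs <;> assumption

theorem patternSet_anti {X J : Type*} (A : J → Set X) (s : J → Bool) {D E : Finset J}
    (h : D ⊆ E) : patternSet A E s ⊆ patternSet A D s :=
  biInter_subset_biInter_left h

open Classical in
/-- Every neighbourhood of `x` contains, modulo `I`, a pattern set whose signs are those of `x`. -/
theorem exists_patternSet_diff_subset {X J : Type*} {I : Set (Set X)} {A : J → Set X}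
    (hI : IsSigmaIdeal I) {U : Set X} (hU : @IsOpen X (idealTopology I A) U) {x : X} (hx : x ∈ U) :
    ∃ D : Finset J, ∃ Z ∈ I, patternSet A D (fun α => decide (x ∈ A α)) \ Z ⊆ U := by
  change TopologicalSpace.GenerateOpen _ U at hU
  induction hU with
  | basic V hV =>
    rcases hV with ⟨α, Z, hZ, rfl⟩ | ⟨α, Z, hZ, rfl⟩
    · exact ⟨{α}, Z, hZ, by simp [patternSet, hx.1]⟩
    · have hxα : x ∉ A α := hx.1
      exact ⟨{α}, Z, hZ, by simp [patternSet, hxα]⟩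
  | univ => exact ⟨∅, ∅, hI.1, subset_univ _⟩
  | inter V W _ _ ihV ihW =>
    obtain ⟨D, Z, hZ, hV⟩ := ihV hx.1
    obtain ⟨E, Y, hY, hW⟩ := ihW hx.2
    exact ⟨D ∪ E, Z ∪ Y, hI.union_mem hZ hY, subset_inter
      ((sdiff_subset_sdiff (patternSet_anti A _ Finset.subset_union_left)
        subset_union_left).trans hV)
      ((sdiff_subset_sdiff (patternSet_anti A _ Finset.subset_union_right)
        subset_union_right).trans hW)⟩
  | sUnion S _ ih =>
    obtain ⟨V, hVS, hxV⟩ := hx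
    obtain ⟨D, Z, hZ, hV⟩ := ih V hVS hxV
    exact ⟨D, Z, hZ, hV.trans (subset_sUnion_of_mem hVS)⟩

theorem stmt_10 {X J : Type*} (I : Set (Set X)) (A : J → Set X)
    (hI : IsSigmaIdeal I) (hX : (Set.univ : Set X) ∉ I) (hsing : ∀ x : X, ({x} : Set X) ∈ I)
    (hind : IndependentModI I A) (hdec : Decomposition I A) (hsep : SeparatesIdeal I A)
    : ∀ x : X, ¬ @IsOpen X (idealTopology I A) {x} := by
  intro x hx
  obtain ⟨D, Z, hZ, hsub⟩ := exists_patternSet_diff_subset hI hx (mem_singleton x)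
  exact hind D _ (hI.2.1 _ _ (sdiff_subset_iff.1 hsub) (hI.union_mem hZ (hsing x)))
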